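/- There exists δ₀ > 0 (depending only on N, α and the Hurst functional index H) such that for all 0 < ε < T with T − ε ≤ δ₀ there exist constants 0 < c₁ ≤ c₂ with the following property: for all u, v ∈ I := [ε,T]^N and every point û = (û₁,…,û_N) with û_l ∈ [min(u_l,v_l), max(u_l,v_l)] for each l, one has c₁ · ∑_{l=1}^N |u_l − v_l|^{h_l(û)} ≤ Φ(u,v) ≤ c₂ · ∑_{l=1}^N |u_l − v_l|^{h_l(û)}. -/

import Mathlib

open MeasureTheory Finset
open scoped ENNReal

/-- `(a₊)^c` with the convention `0^c := 0` for every real exponent `c`. -/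
noncomputable def ppow (a c : ℝ) : ℝ := if 0 < a then a ^ c else 0

/-- The multifractional kernel `g^{H(u)}(u,w)`. -/
noncomputable def kernelG (N : ℕ) (α : ℝ) (h : Fin N → (Fin N → ℝ) → ℝ)
    (u w : Fin N → ℝ) : ℝ :=
  ∏ l, (ppow (u l - w l) (h l u - 1 / α) - ppow (-w l) (h l u - 1 / α))

/-- The `α`-increment (quasi)norm
`Φ(u,v) = (∫_{ℝ^N} |g^{H(u)}(u,w) - g^{H(v)}(v,w)|^α dw)^{1/α}`, valued in `[0,∞]`. -/
noncomputable def PhiNorm (N : ℕ) (α : ℝ) (h : Fin N → (Fin N → ℝ) → ℝ)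
    (u v : Fin N → ℝ) : ℝ≥0∞ :=
  (∫⁻ w : Fin N → ℝ,
    ENNReal.ofReal (|kernelG N α h u w - kernelG N α h v w| ^ α)) ^ (1 / α)

/-- **Tonelli's theorem** for a product of functions of one real coordinate each. -/
theorem lintegral_fin_prod_eq_prod {n : ℕ} (f : Fin n → ℝ → ℝ≥0∞) (hf : ∀ i, Measurable (f i)) :
    ∫⁻ w : Fin n → ℝ, ∏ i, f i (w i) = ∏ i, ∫⁻ x, f i x := by
  induction n with
  | zero => simp [volume_pi]
  | succ n ih =>
    have hm : Measurable fun y : Fin n → ℝ => ∏ i, f i.succ (y i) :=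
      Finset.measurable_prod _ fun i _ => (hf i.succ).comp (measurable_pi_apply i)
    rw [← ((volume_preserving_piFinSuccAbove (fun _ : Fin (n + 1) => ℝ) 0).symm).lintegral_comp_emb
      (MeasurableEquiv.measurableEmbedding _), Measure.volume_eq_prod]
    simp_rw [MeasurableEquiv.piFinSuccAbove_symm_apply, Fin.insertNthEquiv,
      Fin.prod_univ_succ, Fin.insertNth_zero, Equiv.coe_fn_mk, Fin.cons_zero, Fin.cons_succ,
      cast_eq]
    rw [lintegral_prod_mul (hf 0).aemeasurable hm.aemeasurable, ih _ fun i => hf i.succ]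

theorem sum_rpow_le_card_mul {ι : Type*} (s : Finset ι) {x : ι → ℝ} (hx : ∀ i ∈ s, 0 ≤ x i)
    {α : ℝ} (hα : 0 < α) :
    (∑ i ∈ s, x i) ^ α ≤ (s.card : ℝ) ^ α * ∑ i ∈ s, x i ^ α := by
  rcases s.eq_empty_or_nonempty with rfl | hs
  · simp [hα.ne']
  obtain ⟨k, hk, hmax⟩ := s.exists_max_image x hs
  have h1 : ∑ i ∈ s, x i ≤ s.card * x k := by
    simpa using Finset.sum_le_card_nsmul s x (x k) hmax
  calc (∑ i ∈ s, x i) ^ α ≤ (s.card * x k) ^ α :=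
        Real.rpow_le_rpow (Finset.sum_nonneg hx) h1 hα.le
    _ = (s.card : ℝ) ^ α * x k ^ α := Real.mul_rpow (by positivity) (hx k hk)
    _ ≤ _ := by
        gcongr
        exact Finset.single_le_sum (f := fun i => x i ^ α)
          (fun i hi => Real.rpow_nonneg (hx i hi) _) hk

theorem add_rpow_le_two_rpow_mul {x y α : ℝ} (hx : 0 ≤ x) (hy : 0 ≤ y) (hα : 0 < α) :
    (x + y) ^ α ≤ 2 ^ α * (x ^ α + y ^ α) := by
  have := sum_rpow_le_card_mul (Finset.univ : Finset (Fin 2)) (x := ![x, y])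
    (by intro i _; fin_cases i <;> simpa) hα
  simpa using this

theorem abs_exp_sub_exp_le (s t : ℝ) :
    |Real.exp s - Real.exp t| ≤ |s - t| * max (Real.exp s) (Real.exp t) := by
  wlog hst : t ≤ s generalizing s t
  · rw [abs_sub_comm, abs_sub_comm s, max_comm]
    exact this t s (le_of_not_ge hst)
  have h1 : Real.exp t ≤ Real.exp s := Real.exp_le_exp.2 hst
  rw [abs_of_nonneg (by linarith), abs_of_nonneg (by linarith), max_eq_left h1]
  have h2 : Real.exp t = Real.exp s * Real.exp (t - s) := by rw [← Real.exp_add]; ring_nf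
  have h3 := Real.add_one_le_exp (t - s)
  rw [h2]
  nlinarith [Real.exp_pos s]

/-- Lipschitz dependence of `y ^ γ` on the exponent, with a loss of `η` in the exponent. -/
theorem abs_rpow_sub_rpow_le {y γ γ' p q η : ℝ} (hy : 0 < y) (hη : 0 < η)
    (hp : p ≤ γ) (hq : γ ≤ q) (hp' : p ≤ γ') (hq' : γ' ≤ q) :
    |y ^ γ - y ^ γ'| ≤ |γ - γ'| / η * (y ^ (p - η) + y ^ (q + η)) := by
  have key := abs_exp_sub_exp_le (Real.log y * γ) (Real.log y * γ')
  rw [← Real.rpow_def_of_pos hy, ← Real.rpow_def_of_pos hy, ← mul_sub, abs_mul] at key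
  have hlog : |Real.log y| * max (y ^ γ) (y ^ γ') ≤ (y ^ (p - η) + y ^ (q + η)) / η := by
    rcases le_total y 1 with h1 | h1
    · have hm : max (y ^ γ) (y ^ γ') ≤ y ^ p :=
        max_le (Real.rpow_le_rpow_of_exponent_ge hy h1 hp)
          (Real.rpow_le_rpow_of_exponent_ge hy h1 hp')
      have hl : |Real.log y| ≤ y ^ (-η) / η := by
        rw [abs_of_nonpos (Real.log_nonpos hy.le h1), ← Real.log_inv, Real.rpow_neg hy.le,
          ← Real.inv_rpow hy.le]
        exact Real.log_le_rpow_div (inv_nonneg.2 hy.le) hη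
      calc _ ≤ y ^ (-η) / η * y ^ p := by gcongr
        _ = y ^ (p - η) / η := by
          rw [div_mul_eq_mul_div, ← Real.rpow_add hy]; ring_nf
        _ ≤ _ := by
          gcongr
          linarith [Real.rpow_nonneg hy.le (q + η)]
    · have hm : max (y ^ γ) (y ^ γ') ≤ y ^ q :=
        max_le (Real.rpow_le_rpow_of_exponent_le h1 hq)
          (Real.rpow_le_rpow_of_exponent_le h1 hq')
      have hl : |Real.log y| ≤ y ^ η / η := by
        rw [abs_of_nonneg (Real.log_nonneg h1)]
        exact Real.log_le_rpow_div hy.le hη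
      calc _ ≤ y ^ η / η * y ^ q := by gcongr
        _ = y ^ (q + η) / η := by
          rw [div_mul_eq_mul_div, ← Real.rpow_add hy]; ring_nf
        _ ≤ _ := by
          gcongr
          linarith [Real.rpow_nonneg hy.le (p - η)]
  calc _ ≤ _ := key
    _ = |γ - γ'| * (|Real.log y| * max (y ^ γ) (y ^ γ')) := by ring
    _ ≤ |γ - γ'| * ((y ^ (p - η) + y ^ (q + η)) / η) := by gcongr
    _ = _ := by ring

/-- The envelope `x ^ a` on `(0, R]` plus `x ^ b` on `(1, ∞)`. -/
noncomputable def powerEnvelope (R a b x : ℝ) : ℝ :=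
  (Set.Ioc 0 R).indicator (fun t => t ^ a) x + (Set.Ioi 1).indicator (fun t => t ^ b) x

theorem powerEnvelope_nonneg (R a b x : ℝ) : 0 ≤ powerEnvelope R a b x := by
  refine add_nonneg (Set.indicator_nonneg (fun t ht => ?_) x)
    (Set.indicator_nonneg (fun t ht => ?_) x)
  · exact Real.rpow_nonneg ht.1.le _
  · exact Real.rpow_nonneg (zero_le_one.trans (le_of_lt ht)) _

theorem measurable_powerEnvelope (R a b : ℝ) : Measurable (powerEnvelope R a b) :=
  ((measurable_id.pow_const a).indicator measurableSet_Ioc).add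
    ((measurable_id.pow_const b).indicator measurableSet_Ioi)

theorem lintegral_powerEnvelope_rpow_lt_top {R a b α : ℝ} (hR : 0 ≤ R) (hα : 0 < α)
    (ha : -1 < a * α) (hb : b * α < -1) :
    ∫⁻ x, ENNReal.ofReal (powerEnvelope R a b x ^ α) < ∞ := by
  have h1 : Integrable ((Set.Ioc 0 R).indicator fun t : ℝ => t ^ (a * α)) := by
    rw [integrable_indicator_iff measurableSet_Ioc]
    exact (intervalIntegrable_iff_integrableOn_Ioc_of_le hR).1
      (intervalIntegral.intervalIntegrable_rpow' ha)
  have h2 : Integrable ((Set.Ioi 1).indicator fun t : ℝ => t ^ (b * α)) := by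
    rw [integrable_indicator_iff measurableSet_Ioi]
    exact integrableOn_Ioi_rpow_of_lt hb one_pos
  refine lt_of_le_of_lt (lintegral_mono fun x => ENNReal.ofReal_le_ofReal ?_)
    (((h1.add h2).const_mul (2 ^ α)).lintegral_lt_top)
  have e1 : (Set.Ioc 0 R).indicator (fun t : ℝ => t ^ a) x ^ α
      = (Set.Ioc 0 R).indicator (fun t : ℝ => t ^ (a * α)) x := by
    by_cases hx : x ∈ Set.Ioc 0 R
    · simp [hx, Real.rpow_mul hx.1.le]
    · simp [hx, hα.ne']
  have e2 : (Set.Ioi 1).indicator (fun t : ℝ => t ^ b) x ^ α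
      = (Set.Ioi 1).indicator (fun t : ℝ => t ^ (b * α)) x := by
    by_cases hx : x ∈ Set.Ioi 1
    · simp [Set.indicator_of_mem hx, Real.rpow_mul (zero_le_one.trans (le_of_lt hx))]
    · simp [Set.indicator_of_notMem hx, hα.ne']
  have := add_rpow_le_two_rpow_mul (x := (Set.Ioc 0 R).indicator (fun t : ℝ => t ^ a) x)
    (y := (Set.Ioi 1).indicator (fun t : ℝ => t ^ b) x)
    (Set.indicator_nonneg (fun t ht => Real.rpow_nonneg ht.1.le _) x)
    (Set.indicator_nonneg
      (fun t ht => Real.rpow_nonneg (zero_le_one.trans (le_of_lt ht)) _) x) hα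
  rw [e1, e2] at this
  exact this

theorem abs_increment_le_powerEnvelope {φ φ' : ℝ → ℝ} {A T a b v w : ℝ} (hA : 0 ≤ A) (hb : b ≤ 0)
    (hv : 0 ≤ v) (hvT : v ≤ T)
    (hφ : ∀ x, 0 < x → x ≤ T + 1 → |φ x| ≤ A * x ^ a)
    (hder : ∀ x, 1 ≤ x → HasDerivAt φ (φ' x) x) (hφ' : ∀ x, 1 ≤ x → |φ' x| ≤ A * x ^ b) :
    |(if 0 < v - w then φ (v - w) else 0) - (if 0 < -w then φ (-w) else 0)|
      ≤ A * (1 + T) * (powerEnvelope (T + 1) a b (v - w) + powerEnvelope (T + 1) a b (-w)) := by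
  have hG1 := powerEnvelope_nonneg (T + 1) a b (v - w)
  have hG2 := powerEnvelope_nonneg (T + 1) a b (-w)
  have hT : 0 ≤ T := hv.trans hvT
  rcases le_or_gt (-w) 1 with hw | hw
  · have hsmall : ∀ y ≤ T + 1, |if 0 < y then φ y else 0| ≤ A * powerEnvelope (T + 1) a b y := by
      intro y hy
      split_ifs with h0
      · refine (hφ y h0 hy).trans (mul_le_mul_of_nonneg_left ?_ hA)
        have hmem : y ∈ Set.Ioc 0 (T + 1) := ⟨h0, hy⟩
        rw [powerEnvelope, Set.indicator_of_mem hmem]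
        exact le_add_of_nonneg_right (Set.indicator_nonneg
          (fun t ht => Real.rpow_nonneg (zero_le_one.trans (le_of_lt ht)) _) y)
      · simpa using mul_nonneg hA (powerEnvelope_nonneg (T + 1) a b y)
    calc _ ≤ |if 0 < v - w then φ (v - w) else 0| + |if 0 < -w then φ (-w) else 0| := abs_sub _ _
      _ ≤ A * powerEnvelope (T + 1) a b (v - w) + A * powerEnvelope (T + 1) a b (-w) :=
        add_le_add (hsmall _ (by linarith)) (hsmall _ (by linarith))
      _ = A * (powerEnvelope (T + 1) a b (v - w) + powerEnvelope (T + 1) a b (-w)) := by ring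
      _ ≤ _ := by
        gcongr
        nlinarith
  · rw [if_pos (by linarith), if_pos (by linarith)]
    have hmv : ‖φ (v - w) - φ (-w)‖ ≤ A * (-w) ^ b * ‖(v - w) - (-w)‖ := by
      refine (convex_Ici (-w)).norm_image_sub_le_of_norm_hasDerivWithin_le (f' := φ')
        (fun x hx => (hder x (hw.le.trans hx)).hasDerivWithinAt) (fun x hx => ?_)
        Set.self_mem_Ici (Set.mem_Ici.2 (by linarith))
      refine (hφ' x (hw.le.trans hx)).trans (mul_le_mul_of_nonneg_left ?_ hA)
      exact Real.rpow_le_rpow_of_nonpos (by linarith) hx hb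
    have hG : (-w) ^ b ≤ powerEnvelope (T + 1) a b (-w) := by
      have hmem : -w ∈ Set.Ioi (1 : ℝ) := hw
      rw [powerEnvelope, Set.indicator_of_mem hmem]
      exact le_add_of_nonneg_left (Set.indicator_nonneg (fun t ht => Real.rpow_nonneg ht.1.le _) _)
    have hwb : 0 ≤ (-w) ^ b := Real.rpow_nonneg (by linarith) b
    rw [Real.norm_eq_abs, Real.norm_eq_abs, show v - w - -w = v by ring, abs_of_nonneg hv] at hmv
    calc _ ≤ A * (-w) ^ b * v := hmv
      _ = A * v * (-w) ^ b := by ring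
      _ ≤ A * (1 + T) * (powerEnvelope (T + 1) a b (v - w) + powerEnvelope (T + 1) a b (-w)) := by
        gcongr <;> linarith

theorem exists_lintegral_increment_rpow_le {α T a b : ℝ} (hα : 0 < α) (hT : 0 ≤ T) (hb0 : b ≤ 0)
    (ha : -1 < a * α) (hb : b * α < -1) :
    ∃ C : ℝ, 0 ≤ C ∧ ∀ (φ φ' : ℝ → ℝ) (A v : ℝ), 0 ≤ A → 0 ≤ v → v ≤ T →
      (∀ x, 0 < x → x ≤ T + 1 → |φ x| ≤ A * x ^ a) →
      (∀ x, 1 ≤ x → HasDerivAt φ (φ' x) x) → (∀ x, 1 ≤ x → |φ' x| ≤ A * x ^ b) →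
      ∫⁻ w, ENNReal.ofReal (|(if 0 < v - w then φ (v - w) else 0)
        - (if 0 < -w then φ (-w) else 0)| ^ α) ≤ ENNReal.ofReal (C * A ^ α) := by
  set G := powerEnvelope (T + 1) a b with hGdef
  set J := ∫⁻ x, ENNReal.ofReal (G x ^ α) with hJdef
  have hJ : J < ∞ := lintegral_powerEnvelope_rpow_lt_top (by linarith) hα ha hb
  have hGm : Measurable fun x => ENNReal.ofReal (G x ^ α) :=
    ((measurable_powerEnvelope _ _ _).pow_const α).ennreal_ofReal
  refine ⟨(1 + T) ^ α * 2 ^ α * (J.toReal + J.toReal), by positivity, ?_⟩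
  intro φ φ' A v hA hv hvT h1 h2 h3
  have hpt : ∀ w, ENNReal.ofReal (|(if 0 < v - w then φ (v - w) else 0)
        - (if 0 < -w then φ (-w) else 0)| ^ α)
      ≤ ENNReal.ofReal (A ^ α * (1 + T) ^ α * 2 ^ α) *
        (ENNReal.ofReal (G (v - w) ^ α) + ENNReal.ofReal (G (-w) ^ α)) := by
    intro w
    have hG1 : 0 ≤ G (v - w) := powerEnvelope_nonneg _ _ _ _
    have hG2 : 0 ≤ G (-w) := powerEnvelope_nonneg _ _ _ _
    rw [← ENNReal.ofReal_add (by positivity) (by positivity), ← ENNReal.ofReal_mul (by positivity)]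
    refine ENNReal.ofReal_le_ofReal ?_
    calc _ ≤ (A * (1 + T) * (G (v - w) + G (-w))) ^ α :=
          Real.rpow_le_rpow (abs_nonneg _)
            (abs_increment_le_powerEnvelope hA hb0 hv hvT h1 h2 h3) hα.le
      _ = A ^ α * (1 + T) ^ α * (G (v - w) + G (-w)) ^ α := by
          rw [Real.mul_rpow (by positivity) (by positivity), Real.mul_rpow hA (by positivity)]
      _ ≤ A ^ α * (1 + T) ^ α * (2 ^ α * (G (v - w) ^ α + G (-w) ^ α)) := by
          gcongr
          exact add_rpow_le_two_rpow_mul hG1 hG2 hα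
      _ = _ := by ring
  have hI1 : ∫⁻ w, ENNReal.ofReal (G (v - w) ^ α) = J :=
    lintegral_sub_left_eq_self (fun x => ENNReal.ofReal (G x ^ α)) v
  have hI2 : ∫⁻ w, ENNReal.ofReal (G (-w) ^ α) = J := by
    simpa using lintegral_sub_left_eq_self (fun x => ENNReal.ofReal (G x ^ α)) 0
  calc _ ≤ _ := lintegral_mono hpt
    _ = ENNReal.ofReal (A ^ α * (1 + T) ^ α * 2 ^ α) * (J + J) := by
        rw [lintegral_const_mul, lintegral_add_left, hI1, hI2]
        · exact hGm.comp (measurable_const.sub measurable_id)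
        · exact (hGm.comp (measurable_const.sub measurable_id)).add (hGm.comp measurable_neg)
    _ = ENNReal.ofReal (A ^ α * (1 + T) ^ α * 2 ^ α * (J.toReal + J.toReal)) := by
        rw [ENNReal.ofReal_mul (q := J.toReal + J.toReal) (by positivity),
          ENNReal.ofReal_add ENNReal.toReal_nonneg ENNReal.toReal_nonneg,
          ENNReal.ofReal_toReal hJ.ne]
    _ = _ := by congr 1; ring

theorem measurable_ppow (c : ℝ) : Measurable fun x => ppow x c :=
  Measurable.ite measurableSet_Ioi (measurable_id.pow_const c) measurable_const

/-- One-dimensional factor of `kernelG`. -/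
noncomputable def kernelFactor (γ u x : ℝ) : ℝ := ppow (u - x) γ - ppow (-x) γ

theorem measurable_kernelFactor (γ u : ℝ) : Measurable (kernelFactor γ u) :=
  ((measurable_ppow γ).comp (measurable_const.sub measurable_id)).sub
    ((measurable_ppow γ).comp measurable_neg)

theorem exists_lintegral_kernelFactor_rpow_le {α m M T : ℝ} (hα : 0 < α) (hm : 0 < m)
    (hM : M < 1) (hT : 0 ≤ T) :
    ∃ C : ℝ, 0 ≤ C ∧ ∀ h v, m ≤ h → h ≤ M → 0 ≤ v → v ≤ T →
      ∫⁻ w, ENNReal.ofReal (|kernelFactor (h - 1 / α) v w| ^ α) ≤ ENNReal.ofReal C := by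
  set p := m - 1 / α with hp
  set q := M - 1 / α with hq
  have hq1 : q - 1 ≤ 0 := by have : 0 < 1 / α := by positivity
                             linarith
  obtain ⟨C, hC, key⟩ := exists_lintegral_increment_rpow_le (α := α) (T := T) (a := p) (b := q - 1)
    hα hT hq1 (by rw [hp]; field_simp; nlinarith) (by rw [hq]; field_simp; nlinarith)
  set A := (T + 1) ^ (q - p) + (|p| + |q|) with hA
  have hA1 : (T + 1) ^ (q - p) ≤ A := by rw [hA]; linarith [abs_nonneg p, abs_nonneg q]
  have hA2 : |p| + |q| ≤ A := by
    rw [hA]; linarith [Real.rpow_nonneg (by linarith : 0 ≤ T + 1) (q - p)]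
  have hA0 : 0 ≤ A := (by positivity : 0 ≤ |p| + |q|).trans hA2
  refine ⟨C * A ^ α, by positivity, fun h v h1 h2 hv hvT => ?_⟩
  set γ := h - 1 / α with hγ
  have hpγ : p ≤ γ := by linarith
  have hγq : γ ≤ q := by linarith
  refine key (fun x => x ^ γ) (fun x => γ * x ^ (γ - 1)) A v hA0 hv hvT (fun x hx hxT => ?_)
    (fun x hx => Real.hasDerivAt_rpow_const (Or.inl (by linarith))) (fun x hx => ?_)
  · rw [abs_of_nonneg (Real.rpow_nonneg hx.le _)]
    calc x ^ γ = x ^ (γ - p) * x ^ p := by rw [← Real.rpow_add hx]; ring_nf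
      _ ≤ (T + 1) ^ (γ - p) * x ^ p := by gcongr
      _ ≤ (T + 1) ^ (q - p) * x ^ p := by
        gcongr
        all_goals linarith
      _ ≤ A * x ^ p := by gcongr
  · have hx0 : 0 ≤ x := by linarith
    rw [abs_mul, abs_of_nonneg (Real.rpow_nonneg hx0 _)]
    have hγA : |γ| ≤ A := (abs_le_max_abs_abs hpγ hγq).trans
      ((max_le (by linarith [abs_nonneg q]) (by linarith [abs_nonneg p])).trans hA2)
    gcongr

theorem exists_lintegral_kernelFactor_sub_exponent_le {α m M T : ℝ} (hα : 0 < α) (hm : 0 < m)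
    (hM : M < 1) (hT : 0 ≤ T) :
    ∃ C : ℝ, 0 ≤ C ∧ ∀ h h' v, m ≤ h → h ≤ M → m ≤ h' → h' ≤ M → 0 ≤ v → v ≤ T →
      ∫⁻ w, ENNReal.ofReal (|kernelFactor (h - 1 / α) v w - kernelFactor (h' - 1 / α) v w| ^ α)
        ≤ ENNReal.ofReal (C * |h - h'| ^ α) := by
  set η := min m (1 - M) / 2 with hη
  have hη0 : 0 < η := by
    have : 0 < min m (1 - M) := lt_min hm (by linarith)
    positivity
  have hηm : η < m := by linarith [min_le_left m (1 - M)]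
  have hηM : M + η < 1 := by linarith [min_le_right m (1 - M)]
  set p := m - 1 / α with hp
  set q := M - 1 / α with hq
  have hα' : 0 < 1 / α := by positivity
  have hb0 : q - 1 + η ≤ 0 := by linarith
  obtain ⟨C, hC, key⟩ := exists_lintegral_increment_rpow_le (α := α) (T := T) (a := p - η)
    (b := q - 1 + η) hα hT hb0
    (by have : (p - η) * α = (m - η) * α - 1 := by rw [hp]; field_simp; ring
        rw [this]; nlinarith)
    (by have : (q - 1 + η) * α = (M + η - 1) * α - 1 := by rw [hq]; field_simp; ring
        rw [this]; nlinarith)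
  set B₁ := (1 + (T + 1) ^ (q - p + 2 * η)) / η with hB₁
  set B₂ := 1 + (|p| + |q|) * 2 / η with hB₂
  have hB₁0 : 0 ≤ B₁ := by positivity
  have hB₂0 : 0 ≤ B₂ := by positivity
  refine ⟨C * (B₁ + B₂) ^ α, by positivity, fun h h' v h1 h2 h1' h2' hv hvT => ?_⟩
  set γ := h - 1 / α with hγ
  set γ' := h' - 1 / α with hγ'
  have hpγ : p ≤ γ := by linarith
  have hγq : γ ≤ q := by linarith
  have hpγ' : p ≤ γ' := by linarith
  have hγq' : γ' ≤ q := by linarith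
  have hdiff : h - h' = γ - γ' := by rw [hγ, hγ']; ring
  rw [hdiff]
  have := key (fun x => x ^ γ - x ^ γ') (fun x => γ * x ^ (γ - 1) - γ' * x ^ (γ' - 1))
    ((B₁ + B₂) * |γ - γ'|) v (by positivity) hv hvT (fun x hx hxT => ?_)
    (fun x hx => (Real.hasDerivAt_rpow_const (Or.inl (by linarith))).sub
      (Real.hasDerivAt_rpow_const (Or.inl (by linarith)))) (fun x hx => ?_)
  · rw [Real.mul_rpow (by positivity) (abs_nonneg _), ← mul_assoc] at this
    refine le_of_eq_of_le (lintegral_congr fun w => ?_) this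
    congr 3
    simp only [kernelFactor, ppow]
    split_ifs <;> ring
  · have hx2 : x ^ (q + η) ≤ (T + 1) ^ (q - p + 2 * η) * x ^ (p - η) := by
      calc x ^ (q + η) = x ^ (q - p + 2 * η) * x ^ (p - η) := by
            rw [← Real.rpow_add hx]; ring_nf
        _ ≤ _ := by
            gcongr
            linarith
    calc |x ^ γ - x ^ γ'| ≤ |γ - γ'| / η * (x ^ (p - η) + x ^ (q + η)) :=
          abs_rpow_sub_rpow_le hx hη0 hpγ hγq hpγ' hγq'
      _ ≤ |γ - γ'| / η * (x ^ (p - η) + (T + 1) ^ (q - p + 2 * η) * x ^ (p - η)) := by gcongr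
      _ = B₁ * |γ - γ'| * x ^ (p - η) := by rw [hB₁]; ring
      _ ≤ _ := by
          gcongr
          linarith
  · have hx0 : 0 < x := by linarith
    have hγA : |γ'| ≤ |p| + |q| := (abs_le_max_abs_abs hpγ' hγq').trans
      (max_le (by linarith [abs_nonneg q]) (by linarith [abs_nonneg p]))
    have e1 : x ^ (γ - 1) ≤ x ^ (q - 1 + η) :=
      Real.rpow_le_rpow_of_exponent_le hx (by linarith)
    have e2 : x ^ (p - 1 - η) ≤ x ^ (q - 1 + η) :=
      Real.rpow_le_rpow_of_exponent_le hx (by linarith)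
    have e3 : |x ^ (γ - 1) - x ^ (γ' - 1)| ≤ |γ - γ'| / η * (x ^ (q - 1 + η) + x ^ (q - 1 + η)) := by
      have := abs_rpow_sub_rpow_le (γ := γ - 1) (γ' := γ' - 1) (p := p - 1) (q := q - 1) hx0 hη0
        (by linarith) (by linarith) (by linarith) (by linarith)
      rw [show γ - 1 - (γ' - 1) = γ - γ' by ring] at this
      exact this.trans (by gcongr)
    calc |γ * x ^ (γ - 1) - γ' * x ^ (γ' - 1)|
        = |(γ - γ') * x ^ (γ - 1) + γ' * (x ^ (γ - 1) - x ^ (γ' - 1))| := by congr 1; ring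
      _ ≤ |γ - γ'| * x ^ (γ - 1) + |γ'| * |x ^ (γ - 1) - x ^ (γ' - 1)| := by
          refine (abs_add_le _ _).trans_eq ?_
          rw [abs_mul, abs_mul, abs_of_nonneg (Real.rpow_nonneg hx0.le (γ - 1))]
      _ ≤ |γ - γ'| * x ^ (q - 1 + η)
          + (|p| + |q|) * (|γ - γ'| / η * (x ^ (q - 1 + η) + x ^ (q - 1 + η))) := by
          gcongr
      _ = B₂ * |γ - γ'| * x ^ (q - 1 + η) := by rw [hB₂]; ring
      _ ≤ _ := by
          gcongr
          linarith

theorem ppow_pos_mul {d : ℝ} (hd : 0 < d) (x c : ℝ) : ppow (d * x) c = d ^ c * ppow x c := by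
  unfold ppow
  by_cases hx : 0 < x
  · rw [if_pos hx, if_pos (mul_pos hd hx), Real.mul_rpow hd.le hx.le]
  · rw [if_neg hx, if_neg (by rwa [mul_pos_iff_of_pos_left hd]), mul_zero]

theorem lintegral_comp_mul_left_eq {d : ℝ} (hd : 0 < d) {f : ℝ → ℝ≥0∞} (hf : Measurable f) :
    ∫⁻ x, f x = ENNReal.ofReal d * ∫⁻ x, f (d * x) := by
  conv_lhs => rw [← Real.smul_map_volume_mul_left hd.ne']
  rw [lintegral_smul_measure, lintegral_map hf (measurable_const_mul d), abs_of_pos hd,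
    smul_eq_mul]

theorem lintegral_ppow_sub_ppow_scaling {α h u v : ℝ} (hα : 0 < α) (huv : v < u) :
    ∫⁻ w, ENNReal.ofReal (|ppow (u - w) (h - 1 / α) - ppow (v - w) (h - 1 / α)| ^ α)
      = ENNReal.ofReal ((u - v) ^ (h * α)) *
        ∫⁻ w, ENNReal.ofReal (|kernelFactor (h - 1 / α) 1 w| ^ α) := by
  set γ := h - 1 / α with hγ
  have hd : 0 < u - v := by linarith
  set F : ℝ → ℝ≥0∞ := fun x => ENNReal.ofReal (|kernelFactor γ (u - v) x| ^ α) with hF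
  have hFm : Measurable F := ((measurable_kernelFactor _ _).abs.pow_const α).ennreal_ofReal
  have h1 : ∫⁻ w, ENNReal.ofReal (|ppow (u - w) γ - ppow (v - w) γ| ^ α) = ∫⁻ x, F x := by
    rw [← lintegral_add_left_eq_self F (-v)]
    refine lintegral_congr fun w => ?_
    simp only [hF, kernelFactor]
    ring_nf
  have h2 : ∀ x, F ((u - v) * x)
      = ENNReal.ofReal ((u - v) ^ (γ * α)) * ENNReal.ofReal (|kernelFactor γ 1 x| ^ α) := by
    intro x
    have : kernelFactor γ (u - v) ((u - v) * x) = (u - v) ^ γ * kernelFactor γ 1 x := by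
      rw [kernelFactor, kernelFactor, mul_sub, ← ppow_pos_mul hd, ← ppow_pos_mul hd]
      ring_nf
    simp only [hF]
    rw [this, abs_mul, abs_of_pos (Real.rpow_pos_of_pos hd γ), Real.mul_rpow (by positivity)
      (abs_nonneg _), ← Real.rpow_mul hd.le, ENNReal.ofReal_mul (by positivity)]
  rw [h1, lintegral_comp_mul_left_eq hd hFm, lintegral_congr h2, lintegral_const_mul, ← mul_assoc,
    ← ENNReal.ofReal_mul hd.le]
  · congr 2
    rw [show h * α = 1 + γ * α by rw [hγ]; field_simp; ring, Real.rpow_add hd, Real.rpow_one]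
  · exact ((measurable_kernelFactor _ _).abs.pow_const α).ennreal_ofReal

theorem exists_lintegral_ppow_sub_ppow_le {α m M : ℝ} (hα : 0 < α) (hm : 0 < m) (hM : M < 1) :
    ∃ C : ℝ, 0 ≤ C ∧ ∀ h u v, m ≤ h → h ≤ M →
      ∫⁻ w, ENNReal.ofReal (|ppow (u - w) (h - 1 / α) - ppow (v - w) (h - 1 / α)| ^ α)
        ≤ ENNReal.ofReal (C * |u - v| ^ (h * α)) := by
  obtain ⟨C, hC, key⟩ := exists_lintegral_kernelFactor_rpow_le hα hm hM zero_le_one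
  refine ⟨C, hC, fun h u v h1 h2 => ?_⟩
  wlog huv : v ≤ u generalizing u v
  · simp_rw [abs_sub_comm u v, fun w => abs_sub_comm (ppow (u - w) (h - 1 / α))]
    exact this v u (le_of_not_ge huv)
  rcases huv.eq_or_lt with rfl | huv
  · simp [hα.ne']
  · rw [lintegral_ppow_sub_ppow_scaling hα huv, abs_of_pos (by linarith), mul_comm C,
      ENNReal.ofReal_mul (Real.rpow_nonneg (by linarith) _)]
    gcongr
    exact key h 1 h1 h2 zero_le_one le_rfl

theorem exists_lintegral_kernelFactor_sub_le {α m M T : ℝ} (hα : 0 < α) (hm : 0 < m)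
    (hM : M < 1) (hT : 0 ≤ T) :
    ∃ C : ℝ, 0 ≤ C ∧ ∀ h h' u v, m ≤ h → h ≤ M → m ≤ h' → h' ≤ M → 0 ≤ v → v ≤ T →
      ∫⁻ w, ENNReal.ofReal (|kernelFactor (h - 1 / α) u w - kernelFactor (h' - 1 / α) v w| ^ α)
        ≤ ENNReal.ofReal (C * (|u - v| ^ (h * α) + |h - h'| ^ α)) := by
  obtain ⟨C₁, hC₁, key₁⟩ := exists_lintegral_ppow_sub_ppow_le hα hm hM
  obtain ⟨C₂, hC₂, key₂⟩ := exists_lintegral_kernelFactor_sub_exponent_le hα hm hM hT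
  refine ⟨2 ^ α * (C₁ + C₂), by positivity, fun h h' u v h1 h2 h1' h2' hv hvT => ?_⟩
  set γ := h - 1 / α
  set γ' := h' - 1 / α
  have hpt : ∀ w, ENNReal.ofReal (|kernelFactor γ u w - kernelFactor γ' v w| ^ α)
      ≤ ENNReal.ofReal (2 ^ α) * (ENNReal.ofReal (|ppow (u - w) γ - ppow (v - w) γ| ^ α)
        + ENNReal.ofReal (|kernelFactor γ v w - kernelFactor γ' v w| ^ α)) := by
    intro w
    rw [← ENNReal.ofReal_add (by positivity) (by positivity), ← ENNReal.ofReal_mul (by positivity)]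
    refine ENNReal.ofReal_le_ofReal (le_trans ?_
      (add_rpow_le_two_rpow_mul (abs_nonneg _) (abs_nonneg _) hα))
    refine Real.rpow_le_rpow (abs_nonneg _) (le_of_eq_of_le ?_ (abs_add_le _ _)) hα.le
    simp only [kernelFactor]
    congr 1
    ring
  calc _ ≤ _ := lintegral_mono hpt
    _ = ENNReal.ofReal (2 ^ α) * ((∫⁻ w, ENNReal.ofReal (|ppow (u - w) γ - ppow (v - w) γ| ^ α))
        + ∫⁻ w, ENNReal.ofReal (|kernelFactor γ v w - kernelFactor γ' v w| ^ α)) := by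
        have hm2 : Measurable fun w =>
            ENNReal.ofReal (|kernelFactor γ v w - kernelFactor γ' v w| ^ α) :=
          (((measurable_kernelFactor γ v).sub
            (measurable_kernelFactor γ' v)).abs.pow_const α).ennreal_ofReal
        have hm1 : Measurable fun w =>
            ENNReal.ofReal (|ppow (u - w) γ - ppow (v - w) γ| ^ α) :=
          ((((measurable_ppow γ).comp (measurable_const.sub measurable_id)).sub
            ((measurable_ppow γ).comp
              (measurable_const.sub measurable_id))).abs.pow_const α).ennreal_ofReal
        rw [lintegral_const_mul, lintegral_add_left hm1]
        exact hm1.add hm2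
    _ ≤ ENNReal.ofReal (2 ^ α) * (ENNReal.ofReal (C₁ * |u - v| ^ (h * α))
        + ENNReal.ofReal (C₂ * |h - h'| ^ α)) := by
        gcongr
        · exact key₁ h u v h1 h2
        · exact key₂ h h' v h1 h2 h1' h2' hv hvT
    _ ≤ _ := by
        rw [← ENNReal.ofReal_add (by positivity) (by positivity),
          ← ENNReal.ofReal_mul (by positivity)]
        refine ENNReal.ofReal_le_ofReal ?_
        have e1 : 0 ≤ |u - v| ^ (h * α) := by positivity
        have e2 : 0 ≤ |h - h'| ^ α := by positivity
        rw [mul_assoc]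
        gcongr
        nlinarith [mul_nonneg hC₁ e2, mul_nonneg hC₂ e1]

theorem abs_prod_sub_prod_le {ι : Type*} [DecidableEq ι] (s : Finset ι) (f g : ι → ℝ) :
    |∏ i ∈ s, f i - ∏ i ∈ s, g i|
      ≤ ∑ l ∈ s, ∏ j ∈ s, if j = l then |f j - g j| else |f j| + |g j| := by
  induction s using Finset.induction_on with
  | empty => simp
  | insert i s his ih =>
    rw [Finset.prod_insert his, Finset.prod_insert his, Finset.sum_insert his,
      Finset.prod_insert his, if_pos rfl]
    have e1 : ∏ j ∈ s, (if j = i then |f j - g j| else |f j| + |g j|)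
        = ∏ j ∈ s, (|f j| + |g j|) :=
      Finset.prod_congr rfl fun j hj => if_neg (ne_of_mem_of_not_mem hj his)
    have e2 : ∑ l ∈ s, ∏ j ∈ insert i s, (if j = l then |f j - g j| else |f j| + |g j|)
        = (|f i| + |g i|) * ∑ l ∈ s, ∏ j ∈ s,
            (if j = l then |f j - g j| else |f j| + |g j|) := by
      rw [Finset.mul_sum]
      refine Finset.sum_congr rfl fun l hl => ?_
      rw [Finset.prod_insert his, if_neg (ne_of_mem_of_not_mem hl his).symm]
    have e3 : |∏ j ∈ s, f j| ≤ ∏ j ∈ s, (|f j| + |g j|) := by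
      rw [Finset.abs_prod]
      exact Finset.prod_le_prod (fun _ _ => abs_nonneg _)
        fun j _ => le_add_of_nonneg_right (abs_nonneg _)
    rw [e1, e2]
    calc |f i * ∏ j ∈ s, f j - g i * ∏ j ∈ s, g j|
        = |(f i - g i) * ∏ j ∈ s, f j + g i * (∏ j ∈ s, f j - ∏ j ∈ s, g j)| := by
          congr 1; ring
      _ ≤ |f i - g i| * |∏ j ∈ s, f j| + |g i| * |∏ j ∈ s, f j - ∏ j ∈ s, g j| := by
          rw [← abs_mul, ← abs_mul]
          exact abs_add_le _ _
      _ ≤ _ := by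
          gcongr
          exact le_add_of_nonneg_left (abs_nonneg _)

/-- If every factor has `α`-th moment at most `C` and the factors of the two products differ by at
most `C * S ^ α` in `α`-th moment, then the products differ by `O(S)` in `L^α`. -/
theorem lintegral_abs_prod_sub_prod_rpow_le {N : ℕ} {α C S : ℝ} (hα : 0 < α) (hC : 1 ≤ C)
    (hS : 0 ≤ S) (f g : Fin N → ℝ → ℝ) (hfm : ∀ l, Measurable (f l)) (hgm : ∀ l, Measurable (g l))
    (hf : ∀ l, ∫⁻ x, ENNReal.ofReal (|f l x| ^ α) ≤ ENNReal.ofReal C)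
    (hg : ∀ l, ∫⁻ x, ENNReal.ofReal (|g l x| ^ α) ≤ ENNReal.ofReal C)
    (hfg : ∀ l, ∫⁻ x, ENNReal.ofReal (|f l x - g l x| ^ α) ≤ ENNReal.ofReal (C * S ^ α)) :
    ∫⁻ w : Fin N → ℝ, ENNReal.ofReal (|∏ l, f l (w l) - ∏ l, g l (w l)| ^ α)
      ≤ ENNReal.ofReal ((N : ℝ) ^ α * (N * (2 ^ α * (C + C)) ^ N) * S ^ α) := by
  set P : Fin N → Fin N → ℝ → ℝ := fun l j x =>
    if j = l then |f j x - g j x| else |f j x| + |g j x| with hP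
  have hP0 : ∀ l j x, 0 ≤ P l j x := fun l j x => by
    simp only [hP]; split_ifs <;> positivity
  have hPm : ∀ l j, Measurable (P l j) := fun l j => by
    simp only [hP]
    split_ifs
    · exact ((hfm j).sub (hgm j)).abs
    · exact (hfm j).abs.add (hgm j).abs
  have hQm : ∀ l j, Measurable fun x => ENNReal.ofReal (P l j x ^ α) := fun l j =>
    ((hPm l j).pow_const α).ennreal_ofReal
  set D := 2 ^ α * (C + C) with hD
  have h2α : (1 : ℝ) ≤ 2 ^ α := Real.one_le_rpow one_le_two hα.le
  have hD1 : 1 ≤ D := by nlinarith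
  have hpt : ∀ w : Fin N → ℝ, ENNReal.ofReal (|∏ l, f l (w l) - ∏ l, g l (w l)| ^ α)
      ≤ ENNReal.ofReal ((N : ℝ) ^ α) * ∑ l, ∏ j, ENNReal.ofReal (P l j (w j) ^ α) := by
    intro w
    have h0 : ∀ l, 0 ≤ ∏ j, P l j (w j) := fun l => Finset.prod_nonneg fun j _ => hP0 l j _
    have h1 := sum_rpow_le_card_mul (Finset.univ : Finset (Fin N))
      (x := fun l => ∏ j, P l j (w j)) (fun l _ => h0 l) hα
    rw [Finset.card_univ, Fintype.card_fin] at h1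
    have h2 : ∀ l, ∏ j, ENNReal.ofReal (P l j (w j) ^ α)
        = ENNReal.ofReal ((∏ j, P l j (w j)) ^ α) := fun l => by
      rw [← Real.finsetProd_rpow _ _ fun j _ => hP0 l j _, ENNReal.ofReal_prod_of_nonneg]
      exact fun j _ => Real.rpow_nonneg (hP0 l j _) _
    simp_rw [h2]
    rw [← ENNReal.ofReal_sum_of_nonneg fun l _ => Real.rpow_nonneg (h0 l) _,
      ← ENNReal.ofReal_mul (by positivity)]
    refine ENNReal.ofReal_le_ofReal (le_trans ?_ h1)
    exact Real.rpow_le_rpow (abs_nonneg _)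
      (abs_prod_sub_prod_le Finset.univ (fun l => f l (w l)) fun l => g l (w l)) hα.le
  have hfac : ∀ l j, ∫⁻ x, ENNReal.ofReal (P l j x ^ α)
      ≤ ENNReal.ofReal (D * if j = l then S ^ α else 1) := by
    intro l j
    by_cases hjl : j = l
    · simp only [hP, if_pos hjl]
      refine (hfg j).trans (ENNReal.ofReal_le_ofReal ?_)
      gcongr
      nlinarith
    · simp only [hP, if_neg hjl, mul_one]
      have hm1 : Measurable fun x => ENNReal.ofReal (|f j x| ^ α) :=
        ((hfm j).abs.pow_const α).ennreal_ofReal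
      have hm2 : Measurable fun x => ENNReal.ofReal (|g j x| ^ α) :=
        ((hgm j).abs.pow_const α).ennreal_ofReal
      calc ∫⁻ x, ENNReal.ofReal ((|f j x| + |g j x|) ^ α)
          ≤ ∫⁻ x, ENNReal.ofReal (2 ^ α) *
              (ENNReal.ofReal (|f j x| ^ α) + ENNReal.ofReal (|g j x| ^ α)) := by
            refine lintegral_mono fun x => ?_
            rw [← ENNReal.ofReal_add (by positivity) (by positivity),
              ← ENNReal.ofReal_mul (by positivity)]
            exact ENNReal.ofReal_le_ofReal
              (add_rpow_le_two_rpow_mul (abs_nonneg _) (abs_nonneg _) hα)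
        _ = ENNReal.ofReal (2 ^ α) * ((∫⁻ x, ENNReal.ofReal (|f j x| ^ α))
              + ∫⁻ x, ENNReal.ofReal (|g j x| ^ α)) := by
            rw [lintegral_const_mul, lintegral_add_left hm1]
            exact hm1.add hm2
        _ ≤ ENNReal.ofReal (2 ^ α) * (ENNReal.ofReal C + ENNReal.ofReal C) := by
            gcongr
            · exact hf j
            · exact hg j
        _ = ENNReal.ofReal D := by
            rw [← ENNReal.ofReal_add (by positivity) (by positivity),
              ← ENNReal.ofReal_mul (by positivity)]
  have hprod : ∀ l, ∏ j, ∫⁻ x, ENNReal.ofReal (P l j x ^ α)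
      ≤ ENNReal.ofReal (D ^ N * S ^ α) := by
    intro l
    calc _ ≤ ∏ j, ENNReal.ofReal (D * if j = l then S ^ α else 1) :=
          Finset.prod_le_prod' fun j _ => hfac l j
      _ = _ := by
          rw [← ENNReal.ofReal_prod_of_nonneg, Finset.prod_mul_distrib, Finset.prod_ite_eq']
          · simp
          · intro j _
            split_ifs <;> positivity
  have hprodm : ∀ l, Measurable fun w : Fin N → ℝ => ∏ j, ENNReal.ofReal (P l j (w j) ^ α) :=
    fun l => Finset.measurable_prod _ fun j _ => (hQm l j).comp (measurable_pi_apply j)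
  calc _ ≤ _ := lintegral_mono hpt
    _ = ENNReal.ofReal ((N : ℝ) ^ α) * ∑ l, ∏ j, ∫⁻ x, ENNReal.ofReal (P l j x ^ α) := by
        rw [lintegral_const_mul, lintegral_finsetSum _ fun l _ => hprodm l]
        · congr 1
          exact Finset.sum_congr rfl fun l _ => lintegral_fin_prod_eq_prod _ (hQm l)
        · exact Finset.measurable_sum _ fun l _ => hprodm l
    _ ≤ ENNReal.ofReal ((N : ℝ) ^ α) * ∑ _l : Fin N, ENNReal.ofReal (D ^ N * S ^ α) := by
        gcongr with l
        exact hprod l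
    _ = _ := by
        rw [← ENNReal.ofReal_sum_of_nonneg fun _ _ => by positivity,
          ← ENNReal.ofReal_mul (by positivity)]
        congr 1
        simp
        ring

theorem lintegral_Ioo_sub_rpow {u v s : ℝ} (hs : -1 < s) (huv : v ≤ u) :
    ∫⁻ w in Set.Ioo v u, ENNReal.ofReal ((u - w) ^ s)
      = ENNReal.ofReal ((u - v) ^ (s + 1) / (s + 1)) := by
  have hint : IntervalIntegrable (fun w => (u - w) ^ s) volume v u := by
    have := (intervalIntegral.intervalIntegrable_rpow' (a := u - v) (b := u - u) hs).comp_sub_left u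
    simpa using this
  have hval : ∫ w in v..u, (u - w) ^ s = (u - v) ^ (s + 1) / (s + 1) := by
    rw [intervalIntegral.integral_comp_sub_left (fun x => x ^ s) u, integral_rpow (Or.inl hs),
      sub_self, Real.zero_rpow (by linarith), sub_zero]
  rw [← hval, intervalIntegral.integral_of_le huv, integral_Ioc_eq_integral_Ioo,
    ofReal_integral_eq_lintegral_ofReal]
  · exact ((intervalIntegrable_iff_integrableOn_Ioo_of_le huv).1 hint)
  · filter_upwards [ae_restrict_mem measurableSet_Ioo] with w hw
    exact Real.rpow_nonneg (sub_nonneg.2 hw.2.le) s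

/-- Lower bound on the increment norm coming from the slab where the second kernel vanishes. -/
theorem le_lintegral_abs_kernelG_sub_rpow {N : ℕ} {α ε : ℝ} (hα : 0 < α) (hε : 0 < ε)
    {h : Fin N → (Fin N → ℝ) → ℝ} {u v : Fin N → ℝ} (hu : ∀ j, ε ≤ u j) (hv : ∀ j, ε ≤ v j)
    (h0 : ∀ j, 0 < h j u) (h1 : ∀ j, h j u ≤ 1) (l : Fin N) (hl : v l < u l) :
    ENNReal.ofReal (min 1 (min ε 1 ^ α / α) ^ N * (u l - v l) ^ (h l u * α))
      ≤ ∫⁻ w : Fin N → ℝ, ENNReal.ofReal (|kernelG N α h u w - kernelG N α h v w| ^ α) := by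
  set κ := min 1 (min ε 1 ^ α / α) with hκ
  have hε1 : 0 < min ε 1 := lt_min hε one_pos
  have hκ0 : 0 < κ := lt_min one_pos (by positivity)
  set b : Fin N → ℝ := fun j => if j = l then v j else 0 with hb
  have hb0 : ∀ j, 0 ≤ b j := fun j => by
    simp only [hb]; split_ifs
    · exact hε.le.trans (hv j)
    · exact le_rfl
  have hbu : ∀ j, b j ≤ u j := fun j => by
    simp only [hb]; split_ifs with hj
    · rw [hj]; exact hl.le
    · exact hε.le.trans (hu j)
  set F : Fin N → ℝ → ℝ≥0∞ := fun j =>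
    (Set.Ioo (b j) (u j)).indicator fun x => ENNReal.ofReal ((u j - x) ^ (h j u * α - 1)) with hF
  have hFm : ∀ j, Measurable (F j) := fun j =>
    (((measurable_const.sub measurable_id).pow_const _).ennreal_ofReal).indicator measurableSet_Ioo
  have hpt : ∀ w : Fin N → ℝ, ∏ j, F j (w j)
      ≤ ENNReal.ofReal (|kernelG N α h u w - kernelG N α h v w| ^ α) := by
    intro w
    by_cases hw : ∀ j, w j ∈ Set.Ioo (b j) (u j)
    · have hw0 : ∀ j, 0 < w j := fun j => (hb0 j).trans_lt (hw j).1
      have hgu : kernelG N α h u w = ∏ j, (u j - w j) ^ (h j u - 1 / α) := by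
        refine Finset.prod_congr rfl fun j _ => ?_
        rw [ppow, ppow, if_pos (sub_pos.2 (hw j).2), if_neg (by linarith [hw0 j]), sub_zero]
      have hgv : kernelG N α h v w = 0 := by
        refine Finset.prod_eq_zero (Finset.mem_univ l) ?_
        have := (hw l).1
        simp only [hb, if_true] at this
        rw [ppow, ppow, if_neg (by linarith), if_neg (by linarith [hw0 l]), sub_zero]
      have hpos : ∀ j, 0 ≤ (u j - w j) ^ (h j u - 1 / α) := fun j =>
        Real.rpow_nonneg (sub_nonneg.2 (hw j).2.le) _
      rw [hgu, hgv, sub_zero, abs_of_nonneg (Finset.prod_nonneg fun j _ => hpos j),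
        ← Real.finsetProd_rpow _ _ fun j _ => hpos j,
        ENNReal.ofReal_prod_of_nonneg fun j _ => Real.rpow_nonneg (hpos j) _]
      refine le_of_eq (Finset.prod_congr rfl fun j _ => ?_)
      simp only [hF]
      rw [Set.indicator_of_mem (hw j), ← Real.rpow_mul (sub_nonneg.2 (hw j).2.le)]
      congr 2
      field_simp
    · push Not at hw
      obtain ⟨j, hj⟩ := hw
      rw [Finset.prod_eq_zero (Finset.mem_univ j)]
      · exact zero_le
      · simp only [hF]
        exact Set.indicator_of_notMem hj _
  have hval : ∀ j, ∫⁻ x, F j x = ENNReal.ofReal ((u j - b j) ^ (h j u * α) / (h j u * α)) := by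
    intro j
    simp only [hF]
    rw [lintegral_indicator measurableSet_Ioo,
      lintegral_Ioo_sub_rpow (by have := mul_pos (h0 j) hα; linarith) (hbu j), sub_add_cancel]
  have hlow : ∀ j, ENNReal.ofReal (κ * if j = l then (u l - v l) ^ (h l u * α) else 1)
      ≤ ∫⁻ x, F j x := by
    intro j
    rw [hval]
    refine ENNReal.ofReal_le_ofReal ?_
    have hh := h0 j
    have hden : h j u * α ≤ α := by nlinarith [h1 j]
    have hden0 : 0 < h j u * α := by positivity
    have hκ' : κ ≤ 1 / α := (min_le_right _ _).trans (by
      gcongr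
      exact Real.rpow_le_one hε1.le (min_le_right _ _) hα.le)
    by_cases hj : j = l
    · subst hj
      simp only [hb, if_true]
      have hx : 0 ≤ (u j - v j) ^ (h j u * α) := Real.rpow_nonneg (sub_nonneg.2 hl.le) _
      calc _ ≤ 1 / α * (u j - v j) ^ (h j u * α) := by gcongr
        _ ≤ 1 / (h j u * α) * (u j - v j) ^ (h j u * α) := by gcongr
        _ = _ := by ring
    · simp only [hb, if_neg hj, mul_one, sub_zero]
      calc κ ≤ min ε 1 ^ α / α := min_le_right _ _
        _ ≤ min ε 1 ^ (h j u * α) / (h j u * α) := by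
          gcongr ?_ / ?_
          exact Real.rpow_le_rpow_of_exponent_ge hε1 (min_le_right _ _) hden
        _ ≤ u j ^ (h j u * α) / (h j u * α) := by
          gcongr
          exact (min_le_left _ _).trans (hu j)
  calc _ = ∏ j, ENNReal.ofReal (κ * if j = l then (u l - v l) ^ (h l u * α) else 1) := by
        rw [← ENNReal.ofReal_prod_of_nonneg, Finset.prod_mul_distrib, Finset.prod_ite_eq']
        · simp
        · intro j _
          have hx : 0 ≤ (u l - v l) ^ (h l u * α) := Real.rpow_nonneg (sub_nonneg.2 hl.le) _
          split_ifs <;> positivity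
    _ ≤ ∏ j, ∫⁻ x, F j x := Finset.prod_le_prod' fun j _ => hlow j
    _ = ∫⁻ w : Fin N → ℝ, ∏ j, F j (w j) := (lintegral_fin_prod_eq_prod F hFm).symm
    _ ≤ _ := lintegral_mono hpt

/-- Sums `∑ a_k ^ q_k` with small `a` are comparable under perturbations of the exponents
of size `∑ a_k ^ m`. -/
theorem exists_rpow_le_sum_rpow {N : ℕ} {c m : ℝ} (hc : 0 ≤ c) (hm : 0 < m) :
    ∃ C : ℝ, 1 ≤ C ∧ ∀ a p q : Fin N → ℝ, (∀ k, 0 ≤ a k) → (∀ k, a k ≤ 1) →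
      (∀ k, m ≤ p k) → (∀ k, m ≤ q k) → (∀ k, q k ≤ 1) →
      (∀ k, |p k - q k| ≤ c * ∑ j, a j ^ m) → ∀ l, a l ^ p l ≤ C * ∑ k, a k ^ q k := by
  refine ⟨Real.exp (c * N / m ^ 2), Real.one_le_exp (by positivity), ?_⟩
  intro a p q ha0 ha1 hp hq hq1 hpq l
  have hC : 1 ≤ Real.exp (c * N / m ^ 2) := Real.one_le_exp (by positivity)
  have hsum : ∀ k, a k ^ q k ≤ ∑ k, a k ^ q k := fun k =>
    Finset.single_le_sum (f := fun k => a k ^ q k)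
      (fun j _ => Real.rpow_nonneg (ha0 j) _) (Finset.mem_univ k)
  have hsum0 : 0 ≤ ∑ k, a k ^ q k := Finset.sum_nonneg fun j _ => Real.rpow_nonneg (ha0 j) _
  obtain ⟨k, -, hk⟩ := Finset.univ.exists_max_image a ⟨l, Finset.mem_univ l⟩
  rcases (ha0 l).eq_or_lt with hal | hal
  · rw [← hal, Real.zero_rpow (by linarith [hp l])]
    positivity
  have hb : 0 < a k := hal.trans_le (hk l (Finset.mem_univ l))
  rcases le_or_gt (a l) (a k ^ (1 / m)) with hlk | hlk
  · calc a l ^ p l ≤ a l ^ m := Real.rpow_le_rpow_of_exponent_ge hal (ha1 l) (hp l)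
      _ ≤ (a k ^ (1 / m)) ^ m := Real.rpow_le_rpow hal.le hlk hm.le
      _ = a k ^ (1 : ℝ) := by rw [← Real.rpow_mul hb.le]; field_simp
      _ ≤ a k ^ q k := Real.rpow_le_rpow_of_exponent_ge hb (ha1 k) (hq1 k)
      _ ≤ ∑ k, a k ^ q k := hsum k
      _ ≤ _ := le_mul_of_one_le_left hsum0 hC
  · have hd : |p l - q l| ≤ c * (N * a k ^ m) := by
      refine (hpq l).trans (mul_le_mul_of_nonneg_left ?_ hc)
      have := Finset.sum_le_card_nsmul Finset.univ (fun j => a j ^ m) (a k ^ m)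
        fun j hj => Real.rpow_le_rpow (ha0 j) (hk j hj) hm.le
      simpa using this
    have hlogl : -Real.log (a l) ≤ -Real.log (a k) / m := by
      have := Real.log_lt_log (Real.rpow_pos_of_pos hb _) hlk
      rw [Real.log_rpow hb] at this
      have e : -Real.log (a k) / m = -(1 / m * Real.log (a k)) := by ring
      linarith
    have hlogl0 : 0 ≤ -Real.log (a l) := by linarith [Real.log_nonpos hal.le (ha1 l)]
    have hlogk : a k ^ m * -Real.log (a k) ≤ 1 / m := by
      have h1 := Real.log_le_rpow_div (inv_nonneg.2 hb.le) hm
      rw [Real.log_inv, Real.inv_rpow hb.le] at h1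
      have hbm := Real.rpow_pos_of_pos hb m
      calc a k ^ m * -Real.log (a k) ≤ a k ^ m * ((a k ^ m)⁻¹ / m) := by gcongr
        _ = 1 / m := by field_simp
    have hexp : (p l - q l) * Real.log (a l) ≤ c * N / m ^ 2 := by
      calc (p l - q l) * Real.log (a l) = -(p l - q l) * -Real.log (a l) := by ring
        _ ≤ |p l - q l| * -Real.log (a l) :=
          mul_le_mul_of_nonneg_right (neg_le_abs _) hlogl0
        _ ≤ c * (N * a k ^ m) * (-Real.log (a k) / m) := by gcongr
        _ = c * N / m * (a k ^ m * -Real.log (a k)) := by ring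
        _ ≤ c * N / m * (1 / m) := by gcongr
        _ = _ := by ring
    calc a l ^ p l = Real.exp ((p l - q l) * Real.log (a l)) * a l ^ q l := by
          rw [Real.rpow_def_of_pos hal, Real.rpow_def_of_pos hal, ← Real.exp_add]; ring_nf
      _ ≤ Real.exp (c * N / m ^ 2) * ∑ k, a k ^ q k := by
          gcongr
          exact hsum l

theorem PhiNorm_comm (N : ℕ) (α : ℝ) (h : Fin N → (Fin N → ℝ) → ℝ) (u v : Fin N → ℝ) :
    PhiNorm N α h u v = PhiNorm N α h v u := by
  simp only [PhiNorm, abs_sub_comm]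

theorem le_PhiNorm_of_lt {N : ℕ} {α ε : ℝ} (hα : 0 < α) (hε : 0 < ε)
    {h : Fin N → (Fin N → ℝ) → ℝ} {u v : Fin N → ℝ} (hu : ∀ j, ε ≤ u j) (hv : ∀ j, ε ≤ v j)
    (h0 : ∀ j, 0 < h j u) (h1 : ∀ j, h j u ≤ 1) (l : Fin N) (hl : v l < u l) :
    ENNReal.ofReal ((min 1 (min ε 1 ^ α / α) ^ N) ^ (1 / α) * |u l - v l| ^ h l u)
      ≤ PhiNorm N α h u v := by
  have hd : 0 ≤ u l - v l := sub_nonneg.2 hl.le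
  have hε1 : 0 < min ε 1 := lt_min hε one_pos
  have hκ0 : 0 < min 1 (min ε 1 ^ α / α) := lt_min one_pos (by positivity)
  have key := ENNReal.rpow_le_rpow (le_lintegral_abs_kernelG_sub_rpow hα hε hu hv h0 h1 l hl)
    (by positivity : 0 ≤ 1 / α)
  have hx : 0 ≤ (u l - v l) ^ (h l u * α) := Real.rpow_nonneg hd _
  rw [ENNReal.ofReal_rpow_of_nonneg (by positivity) (by positivity),
    Real.mul_rpow (by positivity) hx, ← Real.rpow_mul hd,
    show h l u * α * (1 / α) = h l u by field_simp] at key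
  rwa [abs_of_nonneg hd]

theorem PhiNorm_le_of_factors {N : ℕ} {α C S : ℝ} (hα : 0 < α) (hC : 1 ≤ C) (hS : 0 ≤ S)
    {h : Fin N → (Fin N → ℝ) → ℝ} {u v : Fin N → ℝ}
    (hu : ∀ l, ∫⁻ x, ENNReal.ofReal (|kernelFactor (h l u - 1 / α) (u l) x| ^ α)
      ≤ ENNReal.ofReal C)
    (hv : ∀ l, ∫⁻ x, ENNReal.ofReal (|kernelFactor (h l v - 1 / α) (v l) x| ^ α)
      ≤ ENNReal.ofReal C)
    (huv : ∀ l, ∫⁻ x, ENNReal.ofReal (|kernelFactor (h l u - 1 / α) (u l) x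
      - kernelFactor (h l v - 1 / α) (v l) x| ^ α) ≤ ENNReal.ofReal (C * S ^ α)) :
    PhiNorm N α h u v
      ≤ ENNReal.ofReal (((N : ℝ) ^ α * (N * (2 ^ α * (C + C)) ^ N)) ^ (1 / α) * S) := by
  have key := ENNReal.rpow_le_rpow (lintegral_abs_prod_sub_prod_rpow_le hα hC hS
    (fun l => kernelFactor (h l u - 1 / α) (u l)) (fun l => kernelFactor (h l v - 1 / α) (v l))
    (fun l => measurable_kernelFactor _ _) (fun l => measurable_kernelFactor _ _) hu hv huv)
    (by positivity : 0 ≤ 1 / α)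
  rw [ENNReal.ofReal_rpow_of_nonneg (by positivity) (by positivity),
    Real.mul_rpow (by positivity) (by positivity), ← Real.rpow_mul hS,
    show α * (1 / α) = 1 by field_simp, Real.rpow_one] at key
  exact key

theorem abs_sub_le_abs_sub_of_mem_Icc {x y a b : ℝ} (hx : x ∈ Set.Icc (min a b) (max a b))
    (hy : y ∈ Set.Icc (min a b) (max a b)) : |x - y| ≤ |a - b| := by
  rw [← max_sub_min_eq_abs' a b]
  exact abs_sub_le_iff.2 ⟨by linarith [hx.2, hy.1], by linarith [hy.2, hx.1]⟩

/-- Lemma 2.2: two-sided bounds for the increment norm of LMSS on a small cube. -/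
theorem increment_norm_two_sided_bounds (N : ℕ) (hN : 1 ≤ N) (α : ℝ)
    (hα0 : 0 < α) (hα2 : α ≤ 2)
    (h : Fin N → (Fin N → ℝ) → ℝ) (m M : Fin N → ℝ)
    (hm : ∀ l, 0 < m l) (hmM : ∀ l, m l ≤ M l) (hM1 : ∀ l, M l < 1)
    (hH1 : ∀ l u, m l ≤ h l u ∧ h l u ≤ M l)
    (hH2 : ∀ K : Set (Fin N → ℝ), IsCompact K → ∃ c > 0, ∀ u ∈ K, ∀ v ∈ K, ∀ l,
      |h l u - h l v| ≤ c * ∑ l', min (|u l' - v l'| ^ m l') (|u l' - v l'| ^ M l')) :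
    ∃ δ₀ > (0 : ℝ), ∀ ε T : ℝ, 0 < ε → ε < T → T - ε ≤ δ₀ →
      ∃ c₁ c₂ : ℝ, 0 < c₁ ∧ c₁ ≤ c₂ ∧
        ∀ u v : Fin N → ℝ,
          u ∈ Set.Icc (fun _ => ε) (fun _ => T) →
          v ∈ Set.Icc (fun _ => ε) (fun _ => T) →
          ∀ uhat : Fin N → ℝ,
            (∀ l, uhat l ∈ Set.Icc (min (u l) (v l)) (max (u l) (v l))) →
            ENNReal.ofReal (c₁ * ∑ l, |u l - v l| ^ h l uhat) ≤ PhiNorm N α h u v ∧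
            PhiNorm N α h u v ≤ ENNReal.ofReal (c₂ * ∑ l, |u l - v l| ^ h l uhat) := by
  have : Nonempty (Fin N) := ⟨⟨0, hN⟩⟩
  obtain ⟨lm, hlm⟩ := Finite.exists_min m
  obtain ⟨lM, hlM⟩ := Finite.exists_max M
  set m₀ := m lm
  set M₀ := M lM
  have hm₀ : 0 < m₀ := hm lm
  have hM₀ : M₀ < 1 := hM1 lM
  have hlow : ∀ l x, m₀ ≤ h l x := fun l x => (hlm l).trans (hH1 l x).1
  have hhigh : ∀ l x, h l x ≤ M₀ := fun l x => (hH1 l x).2.trans (hlM l)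
  refine ⟨1, one_pos, fun ε T hε hεT hTε => ?_⟩
  have hT : 0 ≤ T := (hε.trans hεT).le
  obtain ⟨c, hc, hLip⟩ := hH2 (Set.Icc (fun _ => ε) (fun _ => T)) isCompact_Icc
  obtain ⟨C₁, hC₁, hfac⟩ := exists_lintegral_kernelFactor_rpow_le hα0 hm₀ hM₀ hT
  obtain ⟨C₂, hC₂, hsub⟩ := exists_lintegral_kernelFactor_sub_le hα0 hm₀ hM₀ hT
  obtain ⟨C₃, hC₃, hcomp⟩ := exists_rpow_le_sum_rpow (N := N) hc.le hm₀
  set C := 1 + C₁ + C₂ * (C₃ ^ α + c ^ α) with hCdef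
  have hC₁C : C₁ ≤ C := by rw [hCdef]; linarith [show 0 ≤ C₂ * (C₃ ^ α + c ^ α) by positivity]
  have hC1 : 1 ≤ C := by rw [hCdef]; linarith [show 0 ≤ C₂ * (C₃ ^ α + c ^ α) by positivity]
  have hC₂C : C₂ * (C₃ ^ α + c ^ α) ≤ C := by rw [hCdef]; linarith
  set κ := (min 1 (min ε 1 ^ α / α) ^ N) ^ (1 / α) with hκ
  have hκ0 : 0 < κ := by
    have hε1 : 0 < min ε 1 := lt_min hε one_pos
    have : 0 < min 1 (min ε 1 ^ α / α) := lt_min one_pos (by positivity)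
    positivity
  have hN0 : (0 : ℝ) < N := by exact_mod_cast hN
  have hC₃0 : 0 < C₃ := by linarith
  set c₁ := κ / (N * (N * C₃)) with hc₁
  set c₂ := ((N : ℝ) ^ α * (N * (2 ^ α * (C + C)) ^ N)) ^ (1 / α)
  refine ⟨c₁, max c₁ c₂, by positivity, le_max_left _ _, fun u v hu hv uhat huhat => ?_⟩
  set a : Fin N → ℝ := fun k => |u k - v k| with ha
  have ha0 : ∀ k, 0 ≤ a k := fun k => abs_nonneg _
  have ha1 : ∀ k, a k ≤ 1 := fun k => abs_sub_le_iff.2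
    ⟨by linarith [hu.2 k, hv.1 k], by linarith [hv.2 k, hu.1 k]⟩
  have hbox : ∀ x : Fin N → ℝ, (∀ k, x k ∈ Set.Icc (min (u k) (v k)) (max (u k) (v k))) →
      x ∈ Set.Icc (fun _ : Fin N => ε) (fun _ => T) := fun x hx =>
    ⟨fun k => (le_min (hu.1 k) (hv.1 k)).trans (hx k).1,
      fun k => (hx k).2.trans (max_le (hu.2 k) (hv.2 k))⟩
  have hubox : ∀ k, u k ∈ Set.Icc (min (u k) (v k)) (max (u k) (v k)) := fun k =>
    ⟨min_le_left _ _, le_max_left _ _⟩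
  have hvbox : ∀ k, v k ∈ Set.Icc (min (u k) (v k)) (max (u k) (v k)) := fun k =>
    ⟨min_le_right _ _, le_max_right _ _⟩
  have hosc : ∀ x y : Fin N → ℝ, (∀ k, x k ∈ Set.Icc (min (u k) (v k)) (max (u k) (v k))) →
      (∀ k, y k ∈ Set.Icc (min (u k) (v k)) (max (u k) (v k))) → ∀ l,
      |h l x - h l y| ≤ c * ∑ k, a k ^ m₀ := fun x y hx hy l => by
    refine (hLip x (hbox x hx) y (hbox y hy) l).trans ?_
    gcongr with k
    calc _ ≤ |x k - y k| ^ m k := min_le_left _ _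
      _ ≤ a k ^ m k := Real.rpow_le_rpow (abs_nonneg _)
          (abs_sub_le_abs_sub_of_mem_Icc (hx k) (hy k)) (hm k).le
      _ ≤ a k ^ m₀ := Real.rpow_le_rpow_of_exponent_ge' (ha0 k) (ha1 k) hm₀.le (hlm k)
  set S := ∑ l, a l ^ h l uhat with hS
  have hS0 : 0 ≤ S := Finset.sum_nonneg fun k _ => Real.rpow_nonneg (ha0 k) _
  constructor
  · have hslab : ∀ l, ∃ x : Fin N → ℝ,
        (∀ k, x k ∈ Set.Icc (min (u k) (v k)) (max (u k) (v k))) ∧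
        ENNReal.ofReal (κ * a l ^ h l x) ≤ PhiNorm N α h u v := by
      intro l
      rcases lt_trichotomy (u l) (v l) with hl | hl | hl
      · refine ⟨v, hvbox, ?_⟩
        rw [PhiNorm_comm]
        simp only [ha, abs_sub_comm (u l)]
        exact le_PhiNorm_of_lt hα0 hε hv.1 hu.1 (fun j => hm₀.trans_le (hlow j v))
          (fun j => (hhigh j v).trans hM₀.le) l hl
      · refine ⟨u, hubox, ?_⟩
        simp [ha, hl, Real.zero_rpow (hm₀.trans_le (hlow l u)).ne']
      · exact ⟨u, hubox, le_PhiNorm_of_lt hα0 hε hu.1 hv.1 (fun j => hm₀.trans_le (hlow j u))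
          (fun j => (hhigh j u).trans hM₀.le) l hl⟩
    choose x hx hxΦ using hslab
    rcases eq_or_ne (PhiNorm N α h u v) ∞ with htop | htop
    · simp [htop]
    rw [ENNReal.ofReal_le_iff_le_toReal htop]
    have hx' : ∀ l, κ * a l ^ h l (x l) ≤ (PhiNorm N α h u v).toReal := fun l =>
      (ENNReal.ofReal_le_iff_le_toReal htop).1 (hxΦ l)
    have hSle : S ≤ N * (C₃ * ∑ k, a k ^ h k (x k)) := by
      have := Finset.sum_le_card_nsmul Finset.univ (fun l => a l ^ h l uhat) _ fun l _ =>
        hcomp a (fun k => h k uhat) (fun k => h k (x k)) ha0 ha1 (fun k => hlow k _)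
          (fun k => hlow k _) (fun k => (hhigh k _).trans hM₀.le)
          (fun k => hosc uhat (x k) huhat (hx k) k) l
      simpa using this
    have hsumle : κ * ∑ k, a k ^ h k (x k) ≤ N * (PhiNorm N α h u v).toReal := by
      rw [Finset.mul_sum]
      simpa using Finset.sum_le_card_nsmul Finset.univ (fun l => κ * a l ^ h l (x l)) _
        fun l _ => hx' l
    calc c₁ * S ≤ c₁ * (N * (C₃ * ∑ k, a k ^ h k (x k))) := by gcongr
      _ = κ * (∑ k, a k ^ h k (x k)) / N := by rw [hc₁]; field_simp
      _ ≤ _ := by rw [div_le_iff₀ hN0]; linarith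
  · have hmoment : ∀ x ∈ Set.Icc (fun _ : Fin N => ε) (fun _ => T), ∀ l,
        ∫⁻ t, ENNReal.ofReal (|kernelFactor (h l x - 1 / α) (x l) t| ^ α) ≤ ENNReal.ofReal C :=
      fun x hx l => (hfac _ _ (hlow l x) (hhigh l x) (hε.le.trans (hx.1 l)) (hx.2 l)).trans
        (ENNReal.ofReal_le_ofReal hC₁C)
    refine (PhiNorm_le_of_factors hα0 hC1 hS0 (hmoment u hu) (hmoment v hv) fun l => ?_).trans
      (ENNReal.ofReal_le_ofReal (by gcongr; exact le_max_right _ _))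
    refine (hsub _ _ (u l) (v l) (hlow l u) (hhigh l u) (hlow l v) (hhigh l v)
      (hε.le.trans (hv.1 l)) (hv.2 l)).trans (ENNReal.ofReal_le_ofReal ?_)
    have e1 : a l ^ h l u ≤ C₃ * S :=
      hcomp a (fun k => h k u) (fun k => h k uhat) ha0 ha1 (fun k => hlow k _)
        (fun k => hlow k _) (fun k => (hhigh k _).trans hM₀.le)
        (fun k => hosc u uhat hubox huhat k) l
    have e2 : |h l u - h l v| ≤ c * S := by
      refine (hLip u hu v hv l).trans
        (mul_le_mul_of_nonneg_left (Finset.sum_le_sum fun k _ => ?_) hc.le)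
      exact (min_le_right _ _).trans (Real.rpow_le_rpow_of_exponent_ge' (ha0 k) (ha1 k)
        (hm₀.le.trans (hlow k _)) (hH1 k uhat).2)
    calc C₂ * (a l ^ (h l u * α) + |h l u - h l v| ^ α)
        ≤ C₂ * ((C₃ * S) ^ α + (c * S) ^ α) := by
          rw [Real.rpow_mul (ha0 l)]
          have := Real.rpow_nonneg (ha0 l) (h l u)
          gcongr
      _ = C₂ * (C₃ ^ α + c ^ α) * S ^ α := by
          rw [Real.mul_rpow hC₃0.le hS0, Real.mul_rpow hc.le hS0]; ring
      _ ≤ C * S ^ α := by gcongr
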